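/- Suppose 0 ≤ β(d_v−1)(d_c−1) < 1, let μ* be the fixed point of the AMP operator A, suppose that for each edge (i,j) ∈ E the bit x*_{i,j} ∈ {0,1} uniquely maximizes x ↦ μ*_{i→j}(x), and suppose the assignment {x*_{i,j}} is AMP-consistent with common values x*_i. Then x* = {x*_i : i ∈ V_L} is the unique maximum-likelihood codeword: for every codeword x̃ with x̃ ≠ x*, Σ_{i∈V_L} (1−x̃_i)γ_i < Σ_{i∈V_L} (1−x*_i)γ_i. -/

import Mathlib

open Finset Filter

/-- The real value of a bit. -/
def bv (b : Bool) : ℝ := if b then 1 else 0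

/-- `Skin Nc k i x` : the set of local assignments `w` with `w i = x` and even parity
on the neighborhood of check node `k` (the set `S_{k,i}(x)`). -/
def Skin {VL VR : Type*} [Fintype VL] [DecidableEq VL]
    (Nc : VR → Finset VL) (k : VR) (i : VL) (x : Bool) : Finset (VL → Bool) :=
  Finset.univ.filter (fun w => w i = x ∧ Even (((Nc k).filter (fun m => w m = true)).card))

/-- The AMP operator `A`:
`(A[μ])_{i→j}(x) = (1−x)·γ_i + β·Σ_{k∈N(i)\{j}} max_{w∈S_{k,i}(x)} Σ_{m∈N(k)\{i}} μ_{m→k}(w_m)`. -/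
noncomputable def Aop {VL VR : Type*} [Fintype VL] [DecidableEq VL] [DecidableEq VR]
    (Nv : VL → Finset VR) (Nc : VR → Finset VL) (γ : VL → ℝ) (β : ℝ)
    (μ : VL → VR → Bool → ℝ) : VL → VR → Bool → ℝ :=
  fun i j x => (1 - bv x) * γ i +
    β * ∑ k ∈ (Nv i).erase j,
      ⨆ w : {w : VL → Bool // w ∈ Skin Nc k i x}, ∑ m ∈ (Nc k).erase i, μ m k (w.1 m)

/-- Sup-norm over edges (and bits) of an AMP message vector. -/
noncomputable def ampSup {VL VR : Type*} (Nv : VL → Finset VR)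
    (μ : VL → VR → Bool → ℝ) : ℝ :=
  ⨆ p : {q : (VL × VR) × Bool // q.1.2 ∈ Nv q.1.1}, |μ p.1.1.1 p.1.1.2 p.1.2|

/-- The finset of edges of the Tanner graph. -/
def Edges {VL VR : Type*} [Fintype VL] [Fintype VR] [DecidableEq VR]
    (Nv : VL → Finset VR) : Finset (VL × VR) :=
  Finset.univ.filter (fun p => p.2 ∈ Nv p.1)

/-- AMP-consistency of an edge-indexed family of bits: for each variable node all incident
edges carry the same bit, and the resulting vector of common bits is a codeword. -/
def AMPConsistent {VL VR : Type*} (Nv : VL → Finset VR) (Nc : VR → Finset VL)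
    (xs : VL → VR → Bool) : Prop :=
  (∀ i : VL, ∀ j ∈ Nv i, ∀ j' ∈ Nv i, xs i j = xs i j') ∧
  (∀ k : VR, Even (((Nc k).filter (fun i => ∀ j ∈ Nv i, xs i j = true)).card))

theorem sum_sum_erase {ι : Type*} [DecidableEq ι] (s : Finset ι) (f : ι → ℝ) :
    ∑ j ∈ s, ∑ k ∈ s.erase j, f k = ((s.card : ℝ) - 1) * ∑ k ∈ s, f k := by
  rw [Finset.sum_congr rfl fun j hj => Finset.sum_erase_eq_sub (f := f) hj,
    Finset.sum_sub_distrib, Finset.sum_const, nsmul_eq_mul]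
  ring

/-- In a regular bipartite graph, each directed edge message `D m k` feeds into exactly
`(dv - 1) * (dc - 1)` directed edges two steps away. -/
theorem sum_edge_two_step {VL VR : Type*} [Fintype VL] [Fintype VR] [DecidableEq VL]
    [DecidableEq VR] (Nv : VL → Finset VR) (Nc : VR → Finset VL) (dv dc : ℕ)
    (hsym : ∀ (i : VL) (j : VR), j ∈ Nv i ↔ i ∈ Nc j)
    (hdv : ∀ i : VL, (Nv i).card = dv) (hdc : ∀ j : VR, (Nc j).card = dc)
    (D : VL → VR → ℝ) :
    ∑ i, ∑ j ∈ Nv i, ∑ k ∈ (Nv i).erase j, ∑ m ∈ (Nc k).erase i, D m k =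
      ((dv : ℝ) - 1) * ((dc : ℝ) - 1) * ∑ i, ∑ k ∈ Nv i, D i k := by
  have swap : ∀ f : VL → VR → ℝ,
      ∑ i, ∑ k ∈ Nv i, f i k = ∑ k, ∑ i ∈ Nc k, f i k := fun f =>
    Finset.sum_comm' fun i k => by simp [hsym]
  simp_rw [fun i => sum_sum_erase (Nv i) fun k => ∑ m ∈ (Nc k).erase i, D m k, hdv,
    ← Finset.mul_sum]
  rw [swap, swap D]
  simp_rw [fun k => sum_sum_erase (Nc k) fun m => D m k, hdc, ← Finset.mul_sum]
  ring

/-- If the uniquely maximizing bits of the AMP fixed point are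
AMP-consistent, then the vector of common bit values is the unique maximum-likelihood
codeword: every other codeword has strictly smaller correlation `Σ_i (1−x_i)γ_i`. -/
theorem amp_consistent_fixed_point_is_ML
    {VL VR : Type*} [Fintype VL] [Fintype VR] [DecidableEq VL] [DecidableEq VR]
    [Nonempty VL] [Nonempty VR]
    (Nv : VL → Finset VR) (Nc : VR → Finset VL) (dv dc : ℕ)
    (hsym : ∀ (i : VL) (j : VR), j ∈ Nv i ↔ i ∈ Nc j)
    (hdv : ∀ i : VL, (Nv i).card = dv) (hdc : ∀ j : VR, (Nc j).card = dc)
    (hdv2 : 2 ≤ dv) (hdc2 : 2 ≤ dc)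
    (γ : VL → ℝ) (β : ℝ)
    (hβ0 : 0 ≤ β * ((dv : ℝ) - 1) * ((dc : ℝ) - 1))
    (hβ1 : β * ((dv : ℝ) - 1) * ((dc : ℝ) - 1) < 1)
    (μs : VL → VR → Bool → ℝ)
    (hfix : ∀ i : VL, ∀ j ∈ Nv i, ∀ x : Bool, μs i j x = Aop Nv Nc γ β μs i j x)
    (xs : VL → VR → Bool)
    (hmax : ∀ i : VL, ∀ j ∈ Nv i, ∀ b : Bool, b ≠ xs i j → μs i j b < μs i j (xs i j))
    (hcons : AMPConsistent Nv Nc xs)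
    (xv : VL → Bool) (hxv : ∀ i : VL, ∀ j ∈ Nv i, xs i j = xv i) :
    ∀ xt : VL → Bool,
      (∀ k : VR, Even (((Nc k).filter (fun i => xt i = true)).card)) →
      xt ≠ xv →
      ∑ i : VL, (1 - bv (xt i)) * γ i < ∑ i : VL, (1 - bv (xv i)) * γ i := by
  intro xt hxt hne
  have hdv1 : (2 : ℝ) ≤ dv := by exact_mod_cast hdv2
  have hdc1 : (2 : ℝ) ≤ dc := by exact_mod_cast hdc2
  have hβ : 0 ≤ β := by
    rw [mul_assoc] at hβ0
    exact nonneg_of_mul_nonneg_left hβ0 (mul_pos (by linarith) (by linarith))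
  have hNv : ∀ i, (Nv i).Nonempty := fun i => Finset.card_pos.1 (by rw [hdv]; omega)
  have hxvEven : ∀ k, Even (((Nc k).filter (fun i => xv i = true)).card) := by
    intro k
    have h : ∀ i, xv i = true ↔ ∀ j ∈ Nv i, xs i j = true := fun i =>
      ⟨fun h j hj => (hxv i j hj).trans h, fun h => by
        obtain ⟨j, hj⟩ := hNv i
        exact (hxv i j hj).symm.trans (h j hj)⟩
    rw [Finset.filter_congr fun i _ => h i]
    convert hcons.2 k
  have hlt : ∀ i, ∀ j ∈ Nv i, ∀ b, b ≠ xv i → μs i j b < μs i j (xv i) := by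
    intro i j hj b hb
    rw [← hxv i j hj] at hb ⊢
    exact hmax i j hj b hb
  have hle : ∀ i, ∀ j ∈ Nv i, ∀ b, μs i j b ≤ μs i j (xv i) := by
    intro i j hj b
    rcases eq_or_ne b (xv i) with rfl | hb
    · exact le_rfl
    · exact (hlt i j hj b hb).le
  let D : VL → VR → ℝ := fun i j => μs i j (xv i) - μs i j (xt i)
  let g : VL → ℝ := fun i => (1 - bv (xv i)) * γ i - (1 - bv (xt i)) * γ i
  have hD : ∀ i, ∀ j ∈ Nv i,
      D i j ≤ g i + β * ∑ k ∈ (Nv i).erase j, ∑ m ∈ (Nc k).erase i, D m k := by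
    intro i j hj
    have upper : μs i j (xv i) ≤ (1 - bv (xv i)) * γ i +
        β * ∑ k ∈ (Nv i).erase j, ∑ m ∈ (Nc k).erase i, μs m k (xv m) := by
      rw [hfix i j hj, Aop]
      gcongr with k hk
      have : Nonempty {w : VL → Bool // w ∈ Skin Nc k i (xv i)} :=
        ⟨⟨xv, by simpa [Skin] using hxvEven k⟩⟩
      exact ciSup_le fun w => Finset.sum_le_sum fun m hm =>
        hle m k ((hsym m k).2 (Finset.mem_of_mem_erase hm)) _
    have lower : (1 - bv (xt i)) * γ i +
        β * ∑ k ∈ (Nv i).erase j, ∑ m ∈ (Nc k).erase i, μs m k (xt m) ≤ μs i j (xt i) := by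
      rw [hfix i j hj, Aop]
      gcongr with k hk
      exact le_ciSup (f := fun w : {w : VL → Bool // w ∈ Skin Nc k i (xt i)} =>
        ∑ m ∈ (Nc k).erase i, μs m k (w.1 m)) (Set.finite_range _).bddAbove
        ⟨xt, by simpa [Skin] using hxt k⟩
    simp only [D, g, Finset.sum_sub_distrib, mul_sub]
    linarith
  have hsum : ∑ i, ∑ j ∈ Nv i, D i j ≤ dv * ∑ i, g i +
      β * (((dv : ℝ) - 1) * ((dc : ℝ) - 1) * ∑ i, ∑ j ∈ Nv i, D i j) := by
    refine (Finset.sum_le_sum fun i _ => Finset.sum_le_sum (hD i)).trans_eq ?_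
    simp_rw [Finset.sum_add_distrib, ← Finset.mul_sum, Finset.sum_const, hdv, nsmul_eq_mul,
      ← Finset.mul_sum]
    rw [sum_edge_two_step Nv Nc dv dc hsym hdv hdc D]
  have hpos : 0 < ∑ i, ∑ j ∈ Nv i, D i j := by
    obtain ⟨i, hi⟩ := Function.ne_iff.1 hne
    exact Finset.sum_pos'
      (fun i _ => Finset.sum_nonneg fun j hj => sub_nonneg.2 (hle i j hj _))
      ⟨i, Finset.mem_univ i,
        Finset.sum_pos (fun j hj => sub_pos.2 (hlt i j hj _ hi)) (hNv i)⟩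
  have hg : 0 < (dv : ℝ) * ∑ i, g i := by
    have := mul_pos (sub_pos.2 hβ1) hpos
    linarith
  have := pos_of_mul_pos_right hg (by linarith)
  simpa only [g, Finset.sum_sub_distrib, sub_pos] using this
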